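/- arXiv:2605.02852 — 2 statements merged into one kernel-verified Lean document; each statement's English description precedes it below -/
import Mathlib

section
/- Fix a symmetric positive definite N × N matrix Ω, a twice continuously differentiable map f : ℝ^{ℓN} → ℝ^N, and a strictly positive, twice continuously differentiable probability density q on ℝ^{ℓN}. Define the joint density on ℝ^{ℓN} × ℝ^N by p(x, y) := q(x) · (2π)^{−N/2} det(Ω)^{−1/2} exp(−(1/2)(y − f(x))ᵀ Ω⁻¹ (y − f(x))). Write x = (x⁽⁰⁾, …, x⁽ℓ⁻¹⁾) with each block x⁽ᵏ⁾ ∈ ℝ^N, let s_y(x,y) := ∇_y log p(x,y) and s₀(x,y) := ∇_{x⁽⁰⁾} log p(x,y), and let F(x) := ∂f/∂x⁽⁰⁾(x) ∈ ℝ^{N×N} denote the Jacobian of f with respect to the first block. Assume all relevant integrability and boundary-decay conditions hold so that integration by parts applies coordinatewise and all expectations below are finite. Then the cross-block score product matrix satisfies E_p[ s_y · s₀ᵀ ] = −Ω⁻¹ · E_p[ F(x) ], where E_p denotes expectation with respect to the density p. -/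
open MeasureTheory Real Matrix

noncomputable section

lemma aux_quad {N : ℕ} (A : Matrix (Fin N) (Fin N) ℝ) (hA : Aᵀ = A) (m y e : Fin N → ℝ) :
    fderiv ℝ (fun y' : Fin N → ℝ => -(1/2) * ((y' - m) ⬝ᵥ (A *ᵥ (y' - m)))) y e
      = -(e ⬝ᵥ (A *ᵥ (y - m))) := by
  have hd : DifferentiableAt ℝ
      (fun y' : Fin N → ℝ => -(1/2) * ((y' - m) ⬝ᵥ (A *ᵥ (y' - m)))) y := by
    simp only [dotProduct, mulVec, Pi.sub_apply]
    fun_prop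
  rw [← hd.lineDeriv_eq_fderiv]
  unfold lineDeriv
  have hs : (y - m) ⬝ᵥ (A *ᵥ e) = e ⬝ᵥ (A *ᵥ (y - m)) := by
    rw [dotProduct_mulVec, ← mulVec_transpose, hA, dotProduct_comm]
  have : (fun t : ℝ => -(1/2) * ((y + t • e - m) ⬝ᵥ (A *ᵥ (y + t • e - m))))
      = fun t : ℝ => -(1/2) * ((y - m) ⬝ᵥ (A *ᵥ (y - m))) + t * (-(e ⬝ᵥ (A *ᵥ (y - m))))
          + t ^ 2 * (-(1/2) * (e ⬝ᵥ (A *ᵥ e))) := by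
    funext t
    rw [show y + t • e - m = (y - m) + t • e by abel]
    simp only [mulVec_add, mulVec_smul, add_dotProduct, dotProduct_add, smul_dotProduct,
      dotProduct_smul, smul_eq_mul, hs]
    ring
  rw [this]
  have h : HasDerivAt (fun t : ℝ => -(1/2) * ((y - m) ⬝ᵥ (A *ᵥ (y - m)))
        + t * (-(e ⬝ᵥ (A *ᵥ (y - m)))) + t ^ 2 * (-(1/2) * (e ⬝ᵥ (A *ᵥ e))))
      (1 * (-(e ⬝ᵥ (A *ᵥ (y - m)))) + ((2 : ℕ) * (0:ℝ) ^ (2-1) * 1) * (-(1/2) * (e ⬝ᵥ (A *ᵥ e)))) 0 :=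
    (((hasDerivAt_id (0:ℝ)).mul_const _).const_add _).add
      (((hasDerivAt_id (0:ℝ)).pow 2).mul_const _)
  rw [h.deriv]
  simp

/-- **Lag-specific Jacobian recovery (static-window form).**
The window consists of `ℓ` past blocks `x = (x⁽⁰⁾, …, x⁽ℓ⁻¹⁾)`, each in `ℝ^N`, and one
future block `y ∈ ℝ^N`; the joint density is
`p(x, y) = q(x) · (2π)^{-N/2} det(Ω)^{-1/2} exp(-(1/2)(y - f x)ᵀ Ω⁻¹ (y - f x))`.
With `s_y = ∇_y log p`, `s₀ = ∇_{x⁽⁰⁾} log p`, and `F(x) = ∂f/∂x⁽⁰⁾(x)`, and assuming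
the relevant integrability and boundary-decay (vanishing divergence) conditions, the
cross-block score product matrix satisfies `E_p[s_y s₀ᵀ] = -Ω⁻¹ E_p[F]`. -/
theorem cross_block_score_product_recovers_jacobian {N ℓ : ℕ} (hℓ : 0 < ℓ)
    (Ω : Matrix (Fin N) (Fin N) ℝ) (hΩ : Ω.PosDef)
    (f : (Fin ℓ → Fin N → ℝ) → (Fin N → ℝ)) (hf : ContDiff ℝ 2 f)
    (q : (Fin ℓ → Fin N → ℝ) → ℝ) (hq_pos : ∀ x, 0 < q x) (hq : ContDiff ℝ 2 q)
    (hq_prob : ∫ x, q x = 1)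
    (p : (Fin ℓ → Fin N → ℝ) → (Fin N → ℝ) → ℝ)
    (hp : ∀ x y, p x y = q x * (Real.sqrt ((2 * Real.pi) ^ (N : ℕ) * Ω.det))⁻¹ *
        Real.exp (-(1/2) * ((y - f x) ⬝ᵥ (Ω⁻¹ *ᵥ (y - f x)))))
    (sy : (Fin ℓ → Fin N → ℝ) → (Fin N → ℝ) → Fin N → ℝ)
    (hsy : ∀ x y j, sy x y j = fderiv ℝ (fun y' => Real.log (p x y')) y (Pi.single j 1))
    (s0 : (Fin ℓ → Fin N → ℝ) → (Fin N → ℝ) → Fin N → ℝ)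
    (hs0 : ∀ x y i, s0 x y i =
      fderiv ℝ (fun v => Real.log (p (Function.update x ⟨0, hℓ⟩ v) y))
        (x ⟨0, hℓ⟩) (Pi.single i 1))
    (F : (Fin ℓ → Fin N → ℝ) → Matrix (Fin N) (Fin N) ℝ)
    (hF : ∀ x k i, F x k i =
      fderiv ℝ (fun v => f (Function.update x ⟨0, hℓ⟩ v) k) (x ⟨0, hℓ⟩) (Pi.single i 1))
    (h_int1 : ∀ j i, Integrable (fun z : (Fin ℓ → Fin N → ℝ) × (Fin N → ℝ) =>
      sy z.1 z.2 j * s0 z.1 z.2 i * p z.1 z.2))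
    (h_int2 : ∀ k i, Integrable (fun z : (Fin ℓ → Fin N → ℝ) × (Fin N → ℝ) =>
      F z.1 k i * p z.1 z.2))
    (h_boundary : ∀ i j, ∫ z : (Fin ℓ → Fin N → ℝ) × (Fin N → ℝ),
      fderiv ℝ (fun v => p (Function.update z.1 ⟨0, hℓ⟩ v) z.2 *
        sy (Function.update z.1 ⟨0, hℓ⟩ v) z.2 j) (z.1 ⟨0, hℓ⟩) (Pi.single i 1) = 0)
    (EF : Matrix (Fin N) (Fin N) ℝ)
    (hEF : ∀ k i, EF k i = ∫ z : (Fin ℓ → Fin N → ℝ) × (Fin N → ℝ), F z.1 k i * p z.1 z.2) :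
    ∀ j i, (∫ z : (Fin ℓ → Fin N → ℝ) × (Fin N → ℝ), sy z.1 z.2 j * s0 z.1 z.2 i * p z.1 z.2)
      = (-(Ω⁻¹ * EF)) j i := by
  intro j i
  have hA : (Ω⁻¹)ᵀ = Ω⁻¹ := by
    have h := hΩ.isHermitian.inv
    simpa [Matrix.IsHermitian, conjTranspose_eq_transpose_of_trivial] using h
  generalize Ω⁻¹ = A at *
  have hdet := hΩ.det_pos
  have hc : 0 < (Real.sqrt ((2 * Real.pi) ^ (N : ℕ) * Ω.det))⁻¹ := by positivity
  generalize (Real.sqrt ((2 * Real.pi) ^ (N : ℕ) * Ω.det))⁻¹ = c at *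
  have hpos : ∀ x y, 0 < p x y := fun x y => by
    rw [hp]; have := hq_pos x; positivity
  have hsy' : ∀ x y j, sy x y j = -(A *ᵥ (y - f x)) j := by
    intro x y j
    have h1 : (fun y' => Real.log (p x y')) = fun y' =>
        Real.log (q x * c) + -(1/2) * ((y' - f x) ⬝ᵥ (A *ᵥ (y' - f x))) := by
      funext y'
      have := hq_pos x
      rw [hp, Real.log_mul (by positivity) (by positivity), Real.log_exp]
    rw [hsy, h1, fderiv_const_add, aux_quad A hA, single_one_dotProduct]
  have hfd : Differentiable ℝ f := hf.differentiable (by norm_num)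
  have hqd : Differentiable ℝ q := hq.differentiable (by norm_num)
  have hu : ∀ x : Fin ℓ → Fin N → ℝ,
      Differentiable ℝ (fun v : Fin N → ℝ => Function.update x ⟨0, hℓ⟩ v) := fun x v =>
    (hasFDerivAt_update x v).differentiableAt
  have hfu : ∀ x k, Differentiable ℝ (fun v => f (Function.update x ⟨0, hℓ⟩ v) k) :=
    fun x k => differentiable_pi.1 (hfd.comp (hu x)) k
  have hqu : ∀ x, Differentiable ℝ (fun v => q (Function.update x ⟨0, hℓ⟩ v)) :=
    fun x => hqd.comp (hu x)
  have hpu : ∀ x y, Differentiable ℝ (fun v => p (Function.update x ⟨0, hℓ⟩ v) y) := by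
    intro x y
    have h1 := hqu x
    have h2 := hfu x
    simp only [hp, dotProduct, mulVec, Pi.sub_apply]
    fun_prop
  have hsyu : ∀ x y, HasFDerivAt (fun v => sy (Function.update x ⟨0, hℓ⟩ v) y j)
      (∑ k, A j k • fderiv ℝ (fun v => f (Function.update x ⟨0, hℓ⟩ v) k) (x ⟨0, hℓ⟩))
      (x ⟨0, hℓ⟩) := by
    intro x y
    have h1 : (fun v => sy (Function.update x ⟨0, hℓ⟩ v) y j) = fun v =>
        -(A *ᵥ y) j + ∑ k, A j k * f (Function.update x ⟨0, hℓ⟩ v) k := by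
      funext v
      rw [hsy', mulVec_sub, Pi.sub_apply]
      simp only [mulVec, dotProduct]
      ring
    rw [h1]
    exact (HasFDerivAt.fun_sum fun k _ => ((hfu x k _).hasFDerivAt.const_mul (A j k))).const_add _
  have key : ∀ z : (Fin ℓ → Fin N → ℝ) × (Fin N → ℝ),
      fderiv ℝ (fun v => p (Function.update z.1 ⟨0, hℓ⟩ v) z.2 *
        sy (Function.update z.1 ⟨0, hℓ⟩ v) z.2 j) (z.1 ⟨0, hℓ⟩) (Pi.single i 1)
      = sy z.1 z.2 j * s0 z.1 z.2 i * p z.1 z.2 + ∑ k, A j k * (F z.1 k i * p z.1 z.2) := by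
    rintro ⟨x, y⟩
    have hp1 := (hpu x y (x ⟨0, hℓ⟩)).hasFDerivAt
    have hne : p (Function.update x ⟨0, hℓ⟩ (x ⟨0, hℓ⟩)) y ≠ 0 := (hpos _ _).ne'
    have hl := hp1.log hne
    dsimp only
    rw [(hp1.fun_mul (hsyu x y)).fderiv]
    simp only [hs0, hF]
    rw [hl.fderiv]
    simp only [Function.update_eq_self] at hne ⊢
    simp only [_root_.add_apply, _root_.smul_apply, _root_.sum_apply, smul_eq_mul,
      Finset.mul_sum]
    rw [add_comm]
    congr 1
    · field_simp
    · exact Finset.sum_congr rfl fun k _ => by ring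
  have hb := h_boundary i j
  simp only [key] at hb
  rw [integral_add (h_int1 j i) (integrable_finsetSum _ fun k _ => (h_int2 k i).const_mul _),
    integral_finsetSum _ fun k _ => (h_int2 k i).const_mul _] at hb
  simp only [integral_const_mul, ← hEF] at hb
  rw [Matrix.neg_apply, Matrix.mul_apply]
  linarith
end
end

section
/- Let p be a probability density on ℝ^d and σ > 0, and let p_σ denote the density of Z + σε where Z has density p and ε ~ N(0, I_d) is independent of Z, i.e., p_σ is the convolution of p with the Gaussian density of N(0, σ²I_d). Assume p_σ is strictly positive and differentiable with differentiation under the integral valid. Then for any measurable vector field s : ℝ^d → ℝ^d with the relevant square-integrability, the denoising score matching objective satisfies E_{Z, ε}[ ‖ s(Z + σε) + ε/σ ‖² ] = E_{Z̃ ~ p_σ}[ ‖ s(Z̃) − ∇ log p_σ(Z̃) ‖² ] + C, where C is a constant not depending on s. In particular, the minimizer of the denoising objective over s (in L²(p_σ)) is the score of the smoothed density, s*(z̃) = ∇ log p_σ(z̃). -/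
open MeasureTheory Real

noncomputable section

lemma dsm_cov {d : ℕ} (σ : ℝ) (hσ : 0 < σ)
    (f : EuclideanSpace ℝ (Fin d) × EuclideanSpace ℝ (Fin d) → ℝ) :
    (Integrable (fun ze : EuclideanSpace ℝ (Fin d) × EuclideanSpace ℝ (Fin d) =>
        f (ze.1, ze.1 + σ • ze.2)) ↔ Integrable f) ∧
    ∫ ze : EuclideanSpace ℝ (Fin d) × EuclideanSpace ℝ (Fin d),
        f (ze.1, ze.1 + σ • ze.2) = (σ ^ d)⁻¹ * ∫ x, f x := by
  set Φ : EuclideanSpace ℝ (Fin d) × EuclideanSpace ℝ (Fin d) →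
    EuclideanSpace ℝ (Fin d) × EuclideanSpace ℝ (Fin d) :=
      fun ze => (ze.1, ze.1 + σ • ze.2) with hΦ
  have hpos : 0 < (σ ^ d)⁻¹ := by positivity
  have hemb : MeasurableEmbedding Φ := by
    have h1 := (MeasurableEquiv.prodCongr (MeasurableEquiv.refl (EuclideanSpace ℝ (Fin d)))
      (Homeomorph.smulOfNeZero (α := EuclideanSpace ℝ (Fin d)) σ hσ.ne').toMeasurableEquiv).measurableEmbedding
    have h2 := (MeasurableEquiv.shearAddRight (EuclideanSpace ℝ (Fin d))).measurableEmbedding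
    exact h2.comp h1
  have hmap : Measure.map Φ volume = ENNReal.ofReal (σ ^ d)⁻¹ • volume := by
    have h2 := (measurePreserving_prod_add (volume : Measure (EuclideanSpace ℝ (Fin d)))
      (volume : Measure (EuclideanSpace ℝ (Fin d))))
    have hms : Measurable (fun x : EuclideanSpace ℝ (Fin d) => σ • x) := by fun_prop
    have h3 := Measure.map_prod_map (volume : Measure (EuclideanSpace ℝ (Fin d)))
      (volume : Measure (EuclideanSpace ℝ (Fin d))) measurable_id hms
    rw [Measure.map_id, Measure.map_addHaar_smul _ hσ.ne', Measure.prod_smul_right] at h3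
    have : Φ = (fun z : EuclideanSpace ℝ (Fin d) × EuclideanSpace ℝ (Fin d) =>
      (z.1, z.1 + z.2)) ∘ (Prod.map id (fun x => σ • x)) := rfl
    rw [this, ← Measure.map_map h2.measurable (measurable_id.prodMap hms),
      Measure.volume_eq_prod, ← h3, Measure.map_smul, h2.map_eq]
    simp [abs_of_pos hσ]
  constructor
  · have := hemb.integrable_map_iff (μ := volume) (g := f)
    rw [hmap, integrable_smul_measure (by simpa using hpos) (by simp)] at this
    exact this.symm
  · have := hemb.integral_map (μ := volume) f
    rw [hmap, integral_smul_measure] at this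
    rw [← this, ENNReal.toReal_ofReal hpos.le, smul_eq_mul]

lemma dsm_gauss {d : ℕ} {b : ℝ} (hb : 0 < b) :
    Integrable (fun e : EuclideanSpace ℝ (Fin d) => Real.exp (-b * ‖e‖ ^ 2)) := by
  have h := (GaussianFourier.integrable_cexp_neg_mul_sq_norm_add
    (V := EuclideanSpace ℝ (Fin d)) (b := (b : ℂ)) (by simpa using hb) 0 0).norm
  refine h.congr (Filter.Eventually.of_forall fun e => ?_)
  simp only [Complex.norm_exp]
  congr 1
  simp [← Complex.ofReal_pow]

lemma dsm_gauss_sq {d : ℕ} :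
    Integrable (fun e : EuclideanSpace ℝ (Fin d) => ‖e‖ ^ 2 * Real.exp (-(‖e‖ ^ 2) / 2)) := by
  refine ((dsm_gauss (d := d) (b := 1/4) (by norm_num)).const_mul 4).mono' ?_ ?_
  · exact Continuous.aestronglyMeasurable (by fun_prop)
  · refine Filter.Eventually.of_forall fun e => ?_
    rw [Real.norm_of_nonneg (by positivity)]
    have h1 : ‖e‖ ^ 2 / 4 ≤ Real.exp (‖e‖ ^ 2 / 4) := by
      linarith [Real.add_one_le_exp (‖e‖ ^ 2 / 4)]
    have h2 : Real.exp (-(1/4) * ‖e‖ ^ 2) = Real.exp (‖e‖ ^ 2 / 4) * Real.exp (-(‖e‖ ^ 2) / 2) := by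
      rw [← Real.exp_add]; congr 1; ring
    rw [h2]
    have := Real.exp_pos (-(‖e‖ ^ 2) / 2)
    nlinarith

lemma dsm_grad {d : ℕ} (σ : ℝ) (hσ : 0 < σ) (c : ℝ) (z x : EuclideanSpace ℝ (Fin d)) :
    gradient (fun w => c * Real.exp (-(‖w - z‖ ^ 2) / (2 * σ ^ 2))) x =
      -((c * Real.exp (-(‖x - z‖ ^ 2) / (2 * σ ^ 2))) • σ⁻¹ • σ⁻¹ • (x - z)) := by
  apply HasGradientAt.gradient
  rw [hasGradientAt_iff_hasFDerivAt]
  have h := ((((((hasFDerivAt_id x).sub_const z).norm_sq).neg).mul_const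
    ((2 * σ ^ 2)⁻¹)).exp).const_mul c
  simp only [← div_eq_mul_inv] at h
  refine h.congr_fderiv ?_
  ext v
  simp
  field_simp

lemma dsm_grad_log {d : ℕ} (q : EuclideanSpace ℝ (Fin d) → ℝ) (x : EuclideanSpace ℝ (Fin d))
    (hq : DifferentiableAt ℝ q x) (hp : 0 < q x) :
    gradient (fun w => Real.log (q w)) x = (q x)⁻¹ • gradient q x := by
  apply HasGradientAt.gradient
  rw [hasGradientAt_iff_hasFDerivAt]
  refine (hq.hasGradientAt.hasFDerivAt.log hp.ne').congr_fderiv ?_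
  simp

lemma dsm_grad_meas {d : ℕ} (q : EuclideanSpace ℝ (Fin d) → ℝ) : Measurable (gradient q) := by
  unfold gradient
  exact (LinearIsometryEquiv.continuous _).measurable.comp (measurable_fderiv ℝ q)

/-- **Denoising score matching identity.**
Let `p_σ` be the density of `Z + σε` (the convolution of `p` with the `N(0, σ²I)` density),
assumed strictly positive and differentiable with differentiation under the integral valid.
Then there is a constant `C`, not depending on `s`, such that for every measurable vector
field `s` with the relevant square-integrability,
`E_{Z,ε}[‖s(Z + σε) + ε/σ‖²] = E_{Z̃ ~ p_σ}[‖s(Z̃) − ∇ log p_σ(Z̃)‖²] + C`.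
In particular the DSM objective is minimized (in `L²(p_σ)`) by the score of the smoothed
density. -/
theorem denoising_score_matching_identity {d : ℕ} (σ : ℝ) (hσ : 0 < σ)
    (p : EuclideanSpace ℝ (Fin d) → ℝ)
    (hp_nonneg : ∀ z, 0 ≤ p z) (hp_meas : Measurable p)
    (hp_prob : ∫ z, p z = 1)
    (stdG : EuclideanSpace ℝ (Fin d) → ℝ)
    (hstdG : ∀ e, stdG e = (Real.sqrt ((2 * Real.pi) ^ (d : ℕ)))⁻¹ *
      Real.exp (-(‖e‖ ^ 2) / 2))
    (pσ : EuclideanSpace ℝ (Fin d) → ℝ)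
    (hpσ : ∀ zt, pσ zt = ∫ z, p z * ((Real.sqrt ((2 * Real.pi * σ ^ 2) ^ (d : ℕ)))⁻¹ *
      Real.exp (-(‖zt - z‖ ^ 2) / (2 * σ ^ 2))))
    (hpσ_pos : ∀ zt, 0 < pσ zt) (hpσ_diff : Differentiable ℝ pσ)
    (hDUI : ∀ zt, gradient pσ zt = ∫ z, p z •
      gradient (fun w => (Real.sqrt ((2 * Real.pi * σ ^ 2) ^ (d : ℕ)))⁻¹ *
        Real.exp (-(‖w - z‖ ^ 2) / (2 * σ ^ 2))) zt) :
    ∃ C : ℝ, ∀ s : EuclideanSpace ℝ (Fin d) → EuclideanSpace ℝ (Fin d),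
      Measurable s →
      Integrable (fun ze : EuclideanSpace ℝ (Fin d) × EuclideanSpace ℝ (Fin d) =>
        ‖s (ze.1 + σ • ze.2) + σ⁻¹ • ze.2‖ ^ 2 * stdG ze.2 * p ze.1) →
      Integrable (fun zt =>
        ‖s zt - gradient (fun w => Real.log (pσ w)) zt‖ ^ 2 * pσ zt) →
      Integrable (fun zt => ‖s zt‖ ^ 2 * pσ zt) →
      (∫ z, ∫ e, ‖s (z + σ • e) + σ⁻¹ • e‖ ^ 2 * stdG e * p z)
        = (∫ zt, ‖s zt - gradient (fun w => Real.log (pσ w)) zt‖ ^ 2 * pσ zt) + C := by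
  set c : ℝ := (Real.sqrt ((2 * Real.pi * σ ^ 2) ^ (d : ℕ)))⁻¹ with hc
  have hc0 : 0 < c := by positivity
  set k : EuclideanSpace ℝ (Fin d) → ℝ := fun w => c * Real.exp (-(‖w‖ ^ 2) / (2 * σ ^ 2)) with hk
  have hk0 : ∀ w, 0 < k w := fun w => by positivity
  have hkc : Continuous k := by fun_prop
  set K : EuclideanSpace ℝ (Fin d) × EuclideanSpace ℝ (Fin d) → ℝ :=
    fun x => p x.1 * k (x.2 - x.1) with hK
  have hK0 : ∀ x, 0 ≤ K x := fun x => mul_nonneg (hp_nonneg _) (hk0 _).le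
  have hKm : Measurable K := by
    have := hkc.measurable
    fun_prop
  set u : EuclideanSpace ℝ (Fin d) × EuclideanSpace ℝ (Fin d) → EuclideanSpace ℝ (Fin d) :=
    fun x => σ⁻¹ • σ⁻¹ • (x.2 - x.1) with hu
  have hum : Measurable u := by fun_prop
  have huΦ : ∀ z e, u (z, z + σ • e) = σ⁻¹ • e := by
    intro z e
    simp only [hu, add_sub_cancel_left]
    rw [inv_smul_smul₀ hσ.ne']
  have hpσ' : ∀ zt, pσ zt = ∫ z, K (z, zt) := hpσ
  have hstd : ∀ e, stdG e = k (σ • e) * σ ^ d := by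
    intro e
    rw [hstdG]
    simp only [hk, hc]
    have e1 : Real.sqrt ((2 * Real.pi * σ ^ 2) ^ d) = Real.sqrt ((2 * Real.pi) ^ d) * σ ^ d := by
      rw [mul_pow, Real.sqrt_mul (by positivity), ← pow_mul, mul_comm 2 d, pow_mul,
        Real.sqrt_sq (by positivity)]
    have e2 : -(‖σ • e‖ ^ 2) / (2 * σ ^ 2) = -(‖e‖ ^ 2) / 2 := by
      rw [norm_smul, Real.norm_of_nonneg hσ.le]
      field_simp
    rw [e1, e2]
    field_simp
  have hpint : Integrable p := by
    by_contra h
    rw [integral_undef h] at hp_prob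
    exact zero_ne_one hp_prob
  have T : ∀ F : EuclideanSpace ℝ (Fin d) × EuclideanSpace ℝ (Fin d) → ℝ,
      (Integrable (fun ze : EuclideanSpace ℝ (Fin d) × EuclideanSpace ℝ (Fin d) =>
        F (ze.1, ze.1 + σ • ze.2) * stdG ze.2 * p ze.1) ↔ Integrable (fun x => F x * K x)) ∧
      ∫ ze : EuclideanSpace ℝ (Fin d) × EuclideanSpace ℝ (Fin d),
        F (ze.1, ze.1 + σ • ze.2) * stdG ze.2 * p ze.1 = ∫ x, F x * K x := by
    intro F
    have h := dsm_cov σ hσ (fun x => σ ^ d * (F x * K x))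
    have hfun : (fun ze : EuclideanSpace ℝ (Fin d) × EuclideanSpace ℝ (Fin d) =>
        F (ze.1, ze.1 + σ • ze.2) * stdG ze.2 * p ze.1) = fun ze =>
        σ ^ d * (F (ze.1, ze.1 + σ • ze.2) * K (ze.1, ze.1 + σ • ze.2)) := by
      funext ze
      simp only [hK, hstd, add_sub_cancel_left]
      ring
    rw [hfun]
    refine ⟨h.1.trans (integrable_const_mul_iff (by simp [hσ.ne']) _), h.2.trans ?_⟩
    rw [integral_const_mul, inv_mul_cancel_left₀ (by positivity)]
  have hstdint : Integrable stdG := by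
    have := (dsm_gauss (d := d) (b := 1/2) (by norm_num)).const_mul
      (Real.sqrt ((2 * Real.pi) ^ d))⁻¹
    refine this.congr (Filter.Eventually.of_forall fun e => ?_)
    simp only [hstdG]
    congr 2
    ring
  have IK : Integrable K := by
    have h := (T (fun _ => 1)).1.1
    simp only [one_mul] at h
    apply h
    refine (hpint.mul_prod hstdint).congr (Filter.Eventually.of_forall fun e => ?_)
    exact mul_comm _ _
  have Iu : Integrable (fun x => ‖u x‖ ^ 2 * K x) := by
    apply (T (fun x => ‖u x‖ ^ 2)).1.1
    simp only [huΦ]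
    have h := (dsm_gauss_sq (d := d)).const_mul ((σ⁻¹) ^ 2 * (Real.sqrt ((2 * Real.pi) ^ d))⁻¹)
    refine (hpint.mul_prod h).congr (Filter.Eventually.of_forall fun e => ?_)
    simp only [hstdG, norm_smul, Real.norm_of_nonneg (inv_pos.2 hσ).le]
    ring
  have Iv : Integrable (fun x => K x • u x) := by
    refine (IK.add Iu).mono' (hKm.smul hum).aestronglyMeasurable
      (Filter.Eventually.of_forall fun x => ?_)
    rw [norm_smul, Real.norm_of_nonneg (hK0 x)]
    simp only [Pi.add_apply]
    nlinarith [hK0 x, mul_nonneg (hK0 x) (sq_nonneg (‖u x‖ - 1)),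
      mul_nonneg (hK0 x) (sq_nonneg (‖u x‖))]
  have hgrad : ∀ zt, ∫ z, K (z, zt) • u (z, zt) = - gradient pσ zt := by
    intro zt
    rw [hDUI, ← integral_neg]
    congr 1
    funext z
    rw [dsm_grad σ hσ]
    simp only [hK, hk, hu, smul_neg, neg_neg, mul_smul]
  set g : EuclideanSpace ℝ (Fin d) → EuclideanSpace ℝ (Fin d) :=
    gradient (fun w => Real.log (pσ w)) with hg
  have hgm : Measurable g := dsm_grad_meas _
  have hgp : ∀ zt, gradient pσ zt = pσ zt • g zt := by
    intro zt
    rw [hg, dsm_grad_log pσ zt (hpσ_diff zt) (hpσ_pos zt), smul_inv_smul₀ (hpσ_pos zt).ne']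
  have hpm : Measurable pσ := hpσ_diff.continuous.measurable
  refine ⟨(∫ x, ‖u x‖ ^ 2 * K x) - ∫ zt, ‖g zt‖ ^ 2 * pσ zt, ?_⟩
  intro s hs H1 H2 H3
  -- left-hand side
  have hL0 : (∫ z, ∫ e, ‖s (z + σ • e) + σ⁻¹ • e‖ ^ 2 * stdG e * p z)
      = ∫ x, ‖s x.2 + u x‖ ^ 2 * K x := by
    have h := (T (fun x => ‖s x.2 + u x‖ ^ 2)).2
    simp only [huΦ] at h
    rw [← h]
    exact (integral_prod _ H1).symm
  have I1 : Integrable (fun x => ‖s x.2 + u x‖ ^ 2 * K x) := by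
    apply (T (fun x => ‖s x.2 + u x‖ ^ 2)).1.1
    simp only [huΦ]
    exact H1
  have hs2 : Measurable (fun x : EuclideanSpace ℝ (Fin d) × EuclideanSpace ℝ (Fin d) => s x.2) :=
    hs.comp measurable_snd
  have Is : Integrable (fun x => ‖s x.2‖ ^ 2 * K x) := by
    refine ((I1.add Iu).const_mul 2).mono' ((hs2.norm.pow_const 2).mul hKm).aestronglyMeasurable
      (Filter.Eventually.of_forall fun x => ?_)
    rw [Real.norm_of_nonneg (mul_nonneg (sq_nonneg _) (hK0 x))]
    simp only [Pi.add_apply]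
    have h1 := parallelogram_law_with_norm ℝ (s x.2 + u x) (u x)
    rw [add_sub_cancel_right] at h1
    have h2 : ‖s x.2‖ ^ 2 ≤ 2 * (‖s x.2 + u x‖ ^ 2 + ‖u x‖ ^ 2) := by
      nlinarith [sq_nonneg ‖s x.2 + u x + u x‖]
    nlinarith [mul_le_mul_of_nonneg_right h2 (hK0 x)]
  have hexp : ∀ x, ‖s x.2 + u x‖ ^ 2 * K x
      = ‖s x.2‖ ^ 2 * K x + 2 * inner ℝ (s x.2) (K x • u x) + ‖u x‖ ^ 2 * K x := by
    intro x
    rw [norm_add_sq_real, real_inner_smul_right (s x.2) (u x) (K x)]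
    ring
  have Ic : Integrable (fun x : EuclideanSpace ℝ (Fin d) × EuclideanSpace ℝ (Fin d) =>
      inner ℝ (s x.2) (K x • u x)) := by
    refine (((I1.sub Is).sub Iu).const_mul (1/2)).congr (Filter.Eventually.of_forall fun x => ?_)
    simp only [Pi.sub_apply, hexp]
    ring
  have hL1 : ∫ x, ‖s x.2 + u x‖ ^ 2 * K x = (∫ x, ‖s x.2‖ ^ 2 * K x)
      + 2 * (∫ x : EuclideanSpace ℝ (Fin d) × EuclideanSpace ℝ (Fin d),
        inner ℝ (s x.2) (K x • u x)) + ∫ x, ‖u x‖ ^ 2 * K x := by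
    simp only [hexp]
    have h2 : Integrable (fun x : EuclideanSpace ℝ (Fin d) × EuclideanSpace ℝ (Fin d) =>
      ‖s x.2‖ ^ 2 * K x + 2 * inner ℝ (s x.2) (K x • u x)) := Is.add (Ic.const_mul 2)
    rw [integral_add h2 Iu, integral_add Is (Ic.const_mul 2),
      integral_const_mul]
  have hA : ∫ x, ‖s x.2‖ ^ 2 * K x = ∫ zt, ‖s zt‖ ^ 2 * pσ zt := by
    rw [Measure.volume_eq_prod, integral_prod_symm _ Is]
    congr 1
    funext zt
    simp only
    rw [integral_const_mul, hpσ']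
  have hB : ∫ x : EuclideanSpace ℝ (Fin d) × EuclideanSpace ℝ (Fin d),
      inner ℝ (s x.2) (K x • u x) = - ∫ zt, inner ℝ (s zt) (g zt) * pσ zt := by
    rw [Measure.volume_eq_prod, integral_prod_symm _ Ic, ← integral_neg]
    apply integral_congr_ae
    filter_upwards [Iv.prod_left_ae] with zt hzt
    rw [integral_inner hzt, hgrad, hgp, inner_neg_right, inner_smul_right]
    ring
  -- right-hand side
  have Ig : Integrable (fun zt => ‖g zt‖ ^ 2 * pσ zt) := by
    refine ((H2.add H3).const_mul 2).mono' ((hgm.norm.pow_const 2).mul hpm).aestronglyMeasurable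
      (Filter.Eventually.of_forall fun x => ?_)
    rw [Real.norm_of_nonneg (mul_nonneg (sq_nonneg _) (hpσ_pos x).le)]
    simp only [Pi.add_apply]
    have h1 := parallelogram_law_with_norm ℝ (s x) (s x - g x)
    rw [sub_sub_cancel] at h1
    have h2 : ‖g x‖ ^ 2 ≤ 2 * (‖s x - g x‖ ^ 2 + ‖s x‖ ^ 2) := by
      nlinarith [sq_nonneg ‖s x + (s x - g x)‖]
    nlinarith [mul_le_mul_of_nonneg_right h2 (hpσ_pos x).le]
  have hexp2 : ∀ x, ‖s x - g x‖ ^ 2 * pσ x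
      = ‖s x‖ ^ 2 * pσ x - 2 * (inner ℝ (s x) (g x) * pσ x) + ‖g x‖ ^ 2 * pσ x := by
    intro x
    rw [norm_sub_sq_real]
    ring
  have Icg : Integrable (fun x => inner ℝ (s x) (g x) * pσ x) := by
    refine (((H3.add Ig).sub H2).const_mul (1/2)).congr (Filter.Eventually.of_forall fun x => ?_)
    simp only [Pi.sub_apply, Pi.add_apply, hexp2]
    ring
  have hR : ∫ x, ‖s x - g x‖ ^ 2 * pσ x = (∫ x, ‖s x‖ ^ 2 * pσ x)
      - 2 * (∫ x, inner ℝ (s x) (g x) * pσ x) + ∫ x, ‖g x‖ ^ 2 * pσ x := by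
    simp only [hexp2]
    have h2 : Integrable (fun x => ‖s x‖ ^ 2 * pσ x - 2 * (inner ℝ (s x) (g x) * pσ x)) :=
      H3.sub (Icg.const_mul 2)
    rw [integral_add h2 Ig, integral_sub H3 (Icg.const_mul 2),
      integral_const_mul]
  rw [hL0, hL1, hA, hB, hR]
  ring
end
end
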